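/- Let ε₂, ε₃ ∈ ℝ and α ∈ ℝ, and define g(x, μ, α) := α²/2 + x²/2 − ε₂ x ∫_ℝ y dμ(y) + ε₃ α ∫_ℝ y dμ(y) for x ∈ ℝ and μ a Borel probability measure on ℝ with finite second moment. Then for all Borel probability measures μ, μ' on ℝ with finite second moments: [∫ g(x,μ',α) dμ'(x) − ∫ g(x,μ,α) dμ'(x)] − [∫ g(x,μ',α) dμ(x) − ∫ g(x,μ,α) dμ(x)] = −ε₂ (∫ y dμ(y) − ∫ y dμ'(y))². In particular, the generalized Lasry–Lions monotonicity inequality ∫ (g(x,μ',α) − g(x,μ,α)) d(μ'−μ)(x) ≥ −l_g (∫ y d(μ−μ')(y))² holds with l_g = ε₂. -/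

import Mathlib

open MeasureTheory

/-- The running cost of the non-linear-quadratic example:
`g(x,μ,α) = α²/2 + x²/2 − ε₂ x ∫ y dμ + ε₃ α ∫ y dμ`. -/
noncomputable def gNLQ (ε₂ ε₃ : ℝ) (x : ℝ) (μ : Measure ℝ) (α : ℝ) : ℝ :=
  α ^ 2 / 2 + x ^ 2 / 2 - ε₂ * x * (∫ y, y ∂μ) + ε₃ * α * (∫ y, y ∂μ)

theorem integral_gNLQ (ε₂ ε₃ α : ℝ) (μ ν : Measure ℝ) [IsProbabilityMeasure ν]
    (hν : Integrable (fun y : ℝ => y ^ 2) ν) :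
    ∫ x, gNLQ ε₂ ε₃ x μ α ∂ν =
      α ^ 2 / 2 + (∫ x, x ^ 2 ∂ν) / 2 - ε₂ * (∫ x, x ∂ν) * (∫ y, y ∂μ)
        + ε₃ * α * (∫ y, y ∂μ) := by
  have hid : Integrable (fun x : ℝ => x) ν :=
    ((memLp_two_iff_integrable_sq aestronglyMeasurable_id).2 hν).integrable one_le_two
  have hlin : Integrable (fun x : ℝ => ε₂ * x * ∫ y, y ∂μ) ν :=
    (hid.const_mul ε₂).mul_const _
  have hsq : Integrable (fun x : ℝ => α ^ 2 / 2 + x ^ 2 / 2) ν :=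
    (integrable_const _).add (hν.div_const 2)
  have hdiff : Integrable (fun x : ℝ => α ^ 2 / 2 + x ^ 2 / 2 - ε₂ * x * ∫ y, y ∂μ) ν :=
    hsq.sub hlin
  unfold gNLQ
  rw [integral_add hdiff (integrable_const _), integral_sub hsq hlin,
    integral_add (integrable_const _) (hν.div_const 2), integral_mul_const,
    integral_const_mul]
  simp [integral_div]

/-- For all probability measures `μ, μ'` on `ℝ` with finite second
moments, `∫ (g(x,μ',α) − g(x,μ,α)) d(μ'−μ)(x) = −ε₂ (∫ y dμ − ∫ y dμ')²`; in particular
the generalized Lasry–Lions monotonicity inequality holds with `l_g = ε₂`. -/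
theorem statement17 (ε₂ ε₃ α : ℝ) :
    ∀ μ μ' : Measure ℝ, IsProbabilityMeasure μ → IsProbabilityMeasure μ' →
      Integrable (fun y : ℝ => y ^ 2) μ → Integrable (fun y : ℝ => y ^ 2) μ' →
      (((∫ x, gNLQ ε₂ ε₃ x μ' α ∂μ') - ∫ x, gNLQ ε₂ ε₃ x μ α ∂μ') -
          ((∫ x, gNLQ ε₂ ε₃ x μ' α ∂μ) - ∫ x, gNLQ ε₂ ε₃ x μ α ∂μ)
        = -ε₂ * ((∫ y, y ∂μ) - ∫ y, y ∂μ') ^ 2) ∧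
      (-ε₂ * ((∫ y, y ∂μ) - ∫ y, y ∂μ') ^ 2 ≤
        ((∫ x, gNLQ ε₂ ε₃ x μ' α ∂μ') - ∫ x, gNLQ ε₂ ε₃ x μ α ∂μ') -
          ((∫ x, gNLQ ε₂ ε₃ x μ' α ∂μ) - ∫ x, gNLQ ε₂ ε₃ x μ α ∂μ)) := by
  intro μ μ' _ _ hμ hμ'
  rw [integral_gNLQ _ _ _ _ _ hμ, integral_gNLQ _ _ _ _ _ hμ, integral_gNLQ _ _ _ _ _ hμ',
    integral_gNLQ _ _ _ _ _ hμ']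
  have h (a b c d p q : ℝ) :
      c + b / 2 - ε₂ * q * q + d * q - (c + b / 2 - ε₂ * q * p + d * p) -
        (c + a / 2 - ε₂ * p * q + d * q - (c + a / 2 - ε₂ * p * p + d * p)) =
        -ε₂ * (p - q) ^ 2 := by
    ring
  exact ⟨h _ _ _ _ _ _, (h _ _ _ _ _ _).ge⟩
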